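/- arXiv:1010.3176 — 3 statements merged into one kernel-verified Lean document; each statement's English description precedes it below -/
import Mathlib

section
/- Let V be a pre-Lie algebra over ℚ and let ⟨·,·⟩ be an invariant antisymmetric bilinear form on V. Then for all w, x, y, z ∈ V one has ⟨w, x ◁ (y ◁ z)⟩ = −⟨z, y ◁ (x ◁ w)⟩. -/
/-- If `B` is an invariant antisymmetric bilinear form on a pre-Lie
algebra `V` over `ℚ`, then `⟨w, x ◁ (y ◁ z)⟩ = -⟨z, y ◁ (x ◁ w)⟩` for all
`w, x, y, z ∈ V`. -/
theorem invariant_form_depth_two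
    (V : Type*) [AddCommGroup V] [Module ℚ V]
    (op : V →ₗ[ℚ] V →ₗ[ℚ] V)
    (prelie : ∀ x y z : V,
      op (op x y) z - op x (op y z) = op (op x z) y - op x (op z y))
    (B : V →ₗ[ℚ] V →ₗ[ℚ] ℚ)
    (antisym : ∀ x y : V, B x y = - B y x)
    (invariant : ∀ x y z : V, B x (op y z) = B y (op x z - op z x)) :
    ∀ w x y z : V, B w (op x (op y z)) = - B z (op y (op x w)) := by
  have self_adjoint : ∀ x y z : V, B y (op z x) = - B x (op z y) := by
    intro x y z
    have h₁ := invariant x y z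
    have h₂ := invariant y x z
    rw [map_sub] at h₁ h₂
    linarith
  intro w x y z
  rw [self_adjoint, antisym, self_adjoint, neg_neg]
end

section
/- For every n ≥ 1, the number of labeled rooted trees on the vertex set Fin n, i.e. the number of pairs (G, r) where G is a simple graph on Fin n that is a tree (connected and acyclic) and r ∈ Fin n is a distinguished root vertex, equals n^{n−1}. -/
/-- The maps `f : s → V` with no directed cycle, so that iterating `f` always leaves `s`.
They encode the rooted forests on `V` whose set of roots is `sᶜ`. -/
def AcyclicMap {V : Type*} (s : Set V) : Type _ :=
  {f : s → V // ∃ rank : V → ℕ, ∀ v : s, rank (f v) < rank v}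

namespace AcyclicMap

variable {V : Type*}

instance [Finite V] (s : Set V) : Finite (AcyclicMap s) :=
  inferInstanceAs (Finite {_f : s → V // _})

/-- The elements of `s` whose image under an acyclic map stays in `s`. -/
def inner {s : Set V} (f : AcyclicMap s) : Set s := {v | f.1 v ∈ s}

open scoped Classical in
/-- The map on `s` that is given on `t` by a map to `s` and off `t` by a map to `sᶜ`. -/
noncomputable def glue {s : Set V} (t : Set s) (a : (tᶜ : Set s) → (sᶜ : Set V)) (g : t → s) :
    s → V :=
  fun v ↦ if h : v ∈ t then (g ⟨v, h⟩).1 else (a ⟨v, h⟩).1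

lemma glue_mem_iff {s : Set V} (t : Set s) (a : (tᶜ : Set s) → (sᶜ : Set V)) (g : t → s) (v : s) :
    glue t a g v ∈ s ↔ v ∈ t := by
  unfold glue
  split_ifs with h
  · simp [h]
  · exact iff_of_false (a ⟨v, h⟩).2 h

open scoped Classical in
lemma exists_rank_glue {s : Set V} (t : Set s) (a : (tᶜ : Set s) → (sᶜ : Set V)) (g : t → s)
    (hg : ∃ rank : s → ℕ, ∀ v : t, rank (g v) < rank v) :
    ∃ rank : V → ℕ, ∀ v : s, rank (glue t a g v) < rank v := by
  obtain ⟨rank, hrank⟩ := hg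
  refine ⟨fun v ↦ if h : v ∈ s then rank ⟨v, h⟩ + 1 else 0, fun v ↦ ?_⟩
  by_cases h : v ∈ t
  · simpa [glue, h] using hrank ⟨v, h⟩
  · have := (a ⟨v, h⟩).2
    simp only [Set.mem_compl_iff] at this
    simp [glue, h, this]

/-- An acyclic map on `s` with inner set `t` is an arbitrary map `tᶜ → sᶜ` together with an
acyclic map `t → s`. -/
noncomputable def innerFiberEquiv {s : Set V} (t : Set s) :
    ((tᶜ : Set s) → (sᶜ : Set V)) × AcyclicMap t ≃ {f : AcyclicMap s // f.inner = t} where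
  toFun p := ⟨⟨glue t p.1 p.2.1, exists_rank_glue t p.1 p.2.1 p.2.2⟩,
    Set.ext fun v ↦ glue_mem_iff t p.1 p.2.1 v⟩
  invFun f := (fun v ↦ ⟨f.1.1 v, fun h ↦ v.2 (f.2.subset h)⟩,
    ⟨fun v ↦ ⟨f.1.1 v, f.2.symm.subset v.2⟩, by
      obtain ⟨rank, hrank⟩ := f.1.2
      exact ⟨fun v ↦ rank v, fun v ↦ hrank v⟩⟩)
  left_inv p := by
    refine Prod.ext (funext fun v ↦ Subtype.ext ?_)
      (Subtype.ext (funext fun v ↦ Subtype.ext ?_))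
    · exact dif_neg v.2
    · exact dif_pos v.2
  right_inv f := by
    refine Subtype.ext (Subtype.ext (funext fun v ↦ ?_))
    simp only [glue]
    split_ifs <;> rfl

lemma card_eq_sum [Finite V] (s : Set V) [Fintype (Set s)] :
    Nat.card (AcyclicMap s) =
      ∑ t : Set s, Nat.card (sᶜ : Set V) ^ Nat.card (tᶜ : Set s) * Nat.card (AcyclicMap t) := by
  rw [← Nat.card_congr (Equiv.sigmaFiberEquiv (inner (s := s))), Nat.card_sigma]
  refine Finset.sum_congr rfl fun t _ ↦ ?_
  rw [← Nat.card_congr (innerFiberEquiv t), Nat.card_prod, Nat.card_fun]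

end AcyclicMap

lemma sum_choose_mul_pow_mul_pow (k x m : ℕ) :
    ∑ j ∈ Finset.range (m + 2), (m + 1).choose j * (k ^ j * (j * x ^ (m + 1 - j))) =
      k * (m + 1) * (k + x) ^ m := by
  rw [Finset.sum_range_succ', add_pow, Finset.mul_sum]
  simp only [zero_mul, mul_zero, add_zero]
  refine Finset.sum_congr rfl fun j _ ↦ ?_
  have := Nat.add_one_mul_choose_eq m j
  rw [Nat.add_sub_add_right]
  calc _ = k ^ (j + 1) * x ^ (m - j) * ((m + 1).choose (j + 1) * (j + 1)) := by ring
    _ = _ := by rw [← this, Nat.cast_id]; ring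

lemma sum_set_card_compl {α : Type*} [Fintype α] [Fintype (Set α)] (F : ℕ → ℕ) :
    ∑ t : Set α, F (Nat.card (tᶜ : Set α)) =
      ∑ j ∈ Finset.range (Nat.card α + 1), (Nat.card α).choose j * F j := by
  classical
  have h := Finset.sum_powerset_apply_card (x := (Finset.univ : Finset α)) F
  rw [Finset.powerset_univ, Finset.card_univ, ← Nat.card_eq_fintype_card] at h
  simp only [smul_eq_mul] at h
  rw [← h]
  refine Fintype.sum_equiv ((compl_involutive.toPerm _).trans Fintype.finsetEquivSet.symm) _ _ fun t ↦ ?_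
  congr 1
  rw [← Set.ncard_coe_finset, ← Nat.card_coe_set_eq]
  simp

/-- The number of rooted forests on `V` with set of roots `sᶜ`. -/
theorem AcyclicMap.card_mul {V : Type*} [Finite V] (s : Set V) :
    Nat.card (AcyclicMap s) * Nat.card V = Nat.card (sᶜ : Set V) * Nat.card V ^ Nat.card s := by
  classical
  induction h : Nat.card V using Nat.strong_induction_on generalizing V with
  | _ n ih =>
  have := Fintype.ofFinite V
  have hadd : Nat.card s + Nat.card (sᶜ : Set V) = n := by
    rw [← h, Nat.card_coe_set_eq, Nat.card_coe_set_eq, Set.ncard_add_ncard_compl]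
  rcases Nat.eq_zero_or_pos (Nat.card (sᶜ : Set V)) with hk | hk
  · rw [hk, zero_mul, mul_eq_zero, or_iff_not_imp_right]
    intro hn
    have : Nonempty V := Finite.card_pos_iff.1 (by omega)
    have hs : ∀ v, v ∈ s := by
      simpa [Nat.card_coe_set_eq, Set.ncard_eq_zero, Set.eq_univ_iff_forall] using hk
    have : IsEmpty (AcyclicMap s) := by
      refine ⟨fun ⟨f, rank, hrank⟩ ↦ ?_⟩
      obtain ⟨v, hv⟩ := Finite.exists_min rank
      exact (hv _).not_gt (hrank ⟨v, hs v⟩)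
    exact Nat.card_of_isEmpty
  have hlt : Nat.card s < n := by omega
  rcases hm : Nat.card s with _ | m
  · have : IsEmpty s := Finite.card_eq_zero_iff.1 hm
    have : Nat.card (AcyclicMap s) = 1 := Nat.card_eq_one_iff_unique.2
      ⟨⟨fun f g ↦ Subtype.ext (Subsingleton.elim _ _)⟩, ⟨⟨isEmptyElim, 0, isEmptyElim⟩⟩⟩
    rw [this, pow_zero]
    omega
  have hsum : Nat.card (AcyclicMap s) * (m + 1) =
      Nat.card (sᶜ : Set V) * (m + 1) * n ^ m := by
    rw [card_eq_sum, Finset.sum_mul]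
    have key : ∀ t : Set s,
        Nat.card (sᶜ : Set V) ^ Nat.card (tᶜ : Set s) * Nat.card (AcyclicMap t) * (m + 1) =
        Nat.card (sᶜ : Set V) ^ Nat.card (tᶜ : Set s) *
          (Nat.card (tᶜ : Set s) * (m + 1) ^ (m + 1 - Nat.card (tᶜ : Set s))) := by
      intro t
      have ht : Nat.card t = m + 1 - Nat.card (tᶜ : Set s) := by
        rw [← hm, ← Set.ncard_add_ncard_compl t, Nat.card_coe_set_eq, Nat.card_coe_set_eq,
          Nat.add_sub_cancel]
      rw [mul_assoc, ← ht, ih _ (hm ▸ hlt) t hm]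
    rw [Finset.sum_congr rfl fun t _ ↦ key t,
      sum_set_card_compl fun j ↦ Nat.card (sᶜ : Set V) ^ j * (j * (m + 1) ^ (m + 1 - j)), hm,
      sum_choose_mul_pow_mul_pow, ← hadd, hm, add_comm (m + 1)]
  have := Nat.eq_of_mul_eq_mul_right m.succ_pos (hsum.trans (mul_right_comm _ _ _))
  rw [this, pow_succ, mul_assoc]

namespace AcyclicMap

variable {V : Type*} {r : V}

/-- The graph joining every vertex other than the root `r` to its parent. -/
def graph (f : AcyclicMap ({r}ᶜ : Set V)) : SimpleGraph V :=
  SimpleGraph.fromEdgeSet (Set.range fun v : ({r}ᶜ : Set V) ↦ s(v.1, f.1 v))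

lemma graph_adj (f : AcyclicMap ({r}ᶜ : Set V)) (v : ({r}ᶜ : Set V)) : f.graph.Adj v (f.1 v) := by
  obtain ⟨rank, hrank⟩ := f.2
  refine (SimpleGraph.fromEdgeSet_adj _).2 ⟨⟨v, rfl⟩, fun h ↦ (hrank v).ne ?_⟩
  rw [← h]

lemma eq_or_eq_of_graph_adj {f : AcyclicMap ({r}ᶜ : Set V)} {v : ({r}ᶜ : Set V)} {w : V}
    (h : f.graph.Adj v w) : f.1 v = w ∨ ∃ hw : w ∈ ({r}ᶜ : Set V), f.1 ⟨w, hw⟩ = v := by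
  obtain ⟨⟨u, hu⟩, -⟩ := (SimpleGraph.fromEdgeSet_adj _).1 h
  rcases Sym2.eq_iff.1 hu with ⟨h₁, h₂⟩ | ⟨h₁, h₂⟩
  · rw [← Subtype.ext h₁]
    exact .inl h₂
  · subst h₁
    exact .inr ⟨u.2, h₂⟩

lemma graph_connected (f : AcyclicMap ({r}ᶜ : Set V)) : f.graph.Connected := by
  obtain ⟨rank, hrank⟩ := f.2
  have hreach (v : V) : f.graph.Reachable v r := by
    induction h : rank v using Nat.strong_induction_on generalizing v with
    | _ n ih =>
    by_cases hv : v = r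
    · rw [hv]
    · exact (f.graph_adj ⟨v, hv⟩).reachable.trans (ih _ (h ▸ hrank ⟨v, hv⟩) _ rfl)
  have : Nonempty V := ⟨r⟩
  exact ⟨fun u v ↦ (hreach u).trans (hreach v).symm⟩

lemma graph_isTree [Finite V] (f : AcyclicMap ({r}ᶜ : Set V)) : f.graph.IsTree := by
  refine SimpleGraph.isTree_iff_connected_and_card.2 ⟨f.graph_connected,
    le_antisymm ?_ f.graph_connected.card_vert_le_card_edgeSet_add_one⟩
  have hle : f.graph.edgeSet ⊆ Set.range fun v : ({r}ᶜ : Set V) ↦ s(v.1, f.1 v) := by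
    rw [graph, SimpleGraph.edgeSet_fromEdgeSet]
    exact Set.sdiff_subset
  have h := (Nat.card_mono (Set.toFinite _) hle).trans (Finite.card_range_le _)
  rw [← Set.ncard_add_ncard_compl {r}, Set.ncard_singleton, add_comm 1]
  exact Nat.succ_le_succ (h.trans_eq (Nat.card_coe_set_eq _))

lemma graph_injective : Function.Injective (graph (r := r)) := by
  intro f g hfg
  obtain ⟨rank, hrank⟩ := f.2
  refine Subtype.ext (funext fun v ↦ ?_)
  induction h : rank v using Nat.strong_induction_on generalizing v with
  | _ n ih =>
  subst h
  rcases eq_or_eq_of_graph_adj (hfg ▸ f.graph_adj v : g.graph.Adj v (f.1 v)) with h | ⟨hw, h⟩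
  · exact h.symm
  · rw [← ih _ (hrank v) ⟨_, hw⟩ rfl] at h
    have := (hrank ⟨_, hw⟩).trans (hrank v)
    rw [h] at this
    exact absurd this (lt_irrefl _)

lemma exists_graph_eq {G : SimpleGraph V} (hG : G.IsTree) (r : V) :
    ∃ f : AcyclicMap ({r}ᶜ : Set V), f.graph = G := by
  have hpar (v : ({r}ᶜ : Set V)) : ∃ w, G.Adj v w ∧ G.dist w r < G.dist v r := by
    obtain ⟨p, hp⟩ := hG.connected.exists_walk_length_eq_dist v r
    obtain ⟨v, hv⟩ := v
    dsimp only at p hp ⊢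
    cases p with
    | nil => exact absurd rfl hv
    | cons h q => exact ⟨_, h, hp ▸ Nat.lt_succ_of_le (SimpleGraph.dist_le q)⟩
  choose par hadj hdist using hpar
  let f : AcyclicMap ({r}ᶜ : Set V) := ⟨par, fun v ↦ G.dist v r, hdist⟩
  have hle : f.graph ≤ G := by
    rw [graph, SimpleGraph.fromEdgeSet_le]
    rintro _ ⟨⟨v, rfl⟩, -⟩
    exact hadj v
  exact ⟨f, le_antisymm hle
    ((SimpleGraph.isTree_iff_minimal_connected.1 hG).2 f.graph_connected hle)⟩

/-- Trees are in bijection with the acyclic parent maps towards a fixed root. -/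
noncomputable def equivTree [Finite V] (r : V) :
    AcyclicMap ({r}ᶜ : Set V) ≃ {G : SimpleGraph V // G.IsTree} :=
  .ofBijective (fun f ↦ ⟨f.graph, f.graph_isTree⟩)
    ⟨fun _ _ h ↦ graph_injective (congrArg Subtype.val h),
      fun G ↦ (exists_graph_eq G.2 r).imp fun _ h ↦ Subtype.ext h⟩

end AcyclicMap

/-- For `n ≥ 1`, the number of labeled rooted trees on `Fin n`,
i.e. pairs `(G, r)` of a tree `G` on `Fin n` (a connected acyclic simple graph)
and a root vertex `r : Fin n`, equals `n ^ (n - 1)` (Cayley's formula for rooted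
trees). -/
theorem card_rooted_trees (n : ℕ) (hn : 1 ≤ n) :
    Nat.card {p : SimpleGraph (Fin n) × Fin n // p.1.IsTree} = n ^ (n - 1) := by
  have r : Fin n := ⟨0, hn⟩
  have e : {p : SimpleGraph (Fin n) × Fin n // p.1.IsTree} ≃
      {G : SimpleGraph (Fin n) // G.IsTree} × Fin n :=
    { toFun := fun p ↦ (⟨p.1.1, p.2⟩, p.1.2)
      invFun := fun q ↦ ⟨(q.1.1, q.2), q.1.2⟩ }
  have h := AcyclicMap.card_mul ({r}ᶜ : Set (Fin n))
  have hcompl : Nat.card ({r}ᶜ : Set (Fin n)) = n - 1 := by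
    rw [Nat.card_coe_set_eq, Set.ncard_compl, Set.ncard_singleton, Nat.card_fin]
  rw [hcompl, compl_compl, Nat.card_coe_set_eq, Set.ncard_singleton, one_mul, Nat.card_fin] at h
  rw [Nat.card_congr e, Nat.card_prod, ← Nat.card_congr (AcyclicMap.equivTree r), Nat.card_fin, h]
end

section
/- For every n ≥ 2, the number of labeled rooted trees on the vertex set Fin n whose root has valence 1, i.e. the number of pairs (G, r) where G is a simple graph on Fin n that is a tree (connected and acyclic), r ∈ Fin n, and the degree of r in G equals 1, is n · (n−1)^{n−2}. -/
open Finset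

/-- A parent map on `V` with roots in `R` is a rooted forest when iterating it from any vertex
eventually leads to a root. -/
def IsForestMap {V R : Type*} (f : V → V ⊕ R) : Prop :=
  WellFounded fun u v => f v = .inl u

/-- The vertices whose parent is a root. -/
def firstLevel {V R : Type*} [Fintype V] (f : V → V ⊕ R) : Finset V :=
  univ.filter fun v => (f v).isRight

lemma mem_firstLevel {V R : Type*} [Fintype V] {f : V → V ⊕ R} {v : V} :
    v ∈ firstLevel f ↔ ∃ r, f v = .inr r := by
  simp [firstLevel, Sum.isRight_iff]

/-- Attach a forest with root set `J` to the roots in `R` along `g`. -/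
def glueForest {V R : Type*} [DecidableEq V] (J : Finset V) (g : {v // v ∈ J} → R)
    (h : {v // v ∉ J} → {v // v ∉ J} ⊕ {v // v ∈ J}) (v : V) : V ⊕ R :=
  if hv : v ∈ J then .inr (g ⟨v, hv⟩) else .inl (Sum.elim Subtype.val Subtype.val (h ⟨v, hv⟩))

lemma firstLevel_glueForest {V R : Type*} [Fintype V] [DecidableEq V] (J : Finset V)
    (g : {v // v ∈ J} → R) (h : {v // v ∉ J} → {v // v ∉ J} ⊕ {v // v ∈ J}) :
    firstLevel (glueForest J g h) = J := by
  ext v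
  by_cases hv : v ∈ J <;> simp [mem_firstLevel, glueForest, hv]

lemma isForestMap_glueForest_iff {V R : Type*} [DecidableEq V] (J : Finset V)
    (g : {v // v ∈ J} → R) (h : {v // v ∉ J} → {v // v ∉ J} ⊕ {v // v ∈ J}) :
    IsForestMap (glueForest J g h) ↔ IsForestMap h := by
  constructor
  · intro H
    refine Subrelation.wf ?_ (InvImage.wf Subtype.val H)
    intro u v huv
    have hv := v.2
    simp [InvImage, glueForest, hv, huv]
  · intro H
    have hJ : ∀ v ∈ J, Acc (fun u v => glueForest J g h v = .inl u) v := fun v hv =>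
      ⟨v, fun u hu => by simp [glueForest, hv] at hu⟩
    have hJc : ∀ v : {v // v ∉ J}, Acc (fun u v => glueForest J g h v = .inl u) v.1 := by
      intro v
      induction v using H.induction with
      | _ v ih =>
        refine ⟨_, fun u hu => ?_⟩
        have hv := v.2
        simp only [glueForest, hv, dite_false, Sum.inl.injEq] at hu
        rcases hh : h v with w | w
        · rw [hh] at hu
          exact hu ▸ ih w hh
        · rw [hh] at hu
          exact hu ▸ hJ _ w.2
    exact ⟨fun v => if hv : v ∈ J then hJ v hv else hJc ⟨v, hv⟩⟩

lemma glueForest_injective {V R : Type*} [DecidableEq V] (J : Finset V) :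
    Function.Injective fun p : ({v // v ∈ J} → R) ×
      ({v // v ∉ J} → {v // v ∉ J} ⊕ {v // v ∈ J}) => glueForest J p.1 p.2 := by
  rintro ⟨g, h⟩ ⟨g', h'⟩ H
  refine Prod.ext (funext fun v => ?_) (funext fun v => ?_)
  · have hv := v.2
    simpa [glueForest, hv] using congrFun H v.1
  · have hv := v.2
    have e := congrFun H v.1
    simp only [glueForest, hv, dite_false, Sum.inl.injEq, Subtype.coe_eta] at e
    change h v = h' v
    rcases hh : h v with a | a <;> rcases hh' : h' v with b | b <;> rw [hh, hh'] at e
    · exact congrArg _ (Subtype.ext e)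
    · exact absurd b.2 ((show a.1 = b.1 from e) ▸ a.2)
    · exact absurd a.2 ((show a.1 = b.1 from e) ▸ b.2)
    · exact congrArg _ (Subtype.ext e)

lemma exists_glueForest_eq {V R : Type*} [Fintype V] [DecidableEq V] (f : V → V ⊕ R) :
    ∃ g h, glueForest (firstLevel f) g h = f := by
  have h1 : ∀ v : {v // v ∈ firstLevel f}, ∃ r, f v = .inr r := fun v => mem_firstLevel.1 v.2
  have h2 : ∀ v : {v // v ∉ firstLevel f},
      ∃ w : {v // v ∉ firstLevel f} ⊕ {v // v ∈ firstLevel f},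
        f v = .inl (Sum.elim Subtype.val Subtype.val w) := by
    intro v
    rcases hv : f v with u | r
    · by_cases hu : u ∈ firstLevel f
      · exact ⟨.inr ⟨u, hu⟩, rfl⟩
      · exact ⟨.inl ⟨u, hu⟩, rfl⟩
    · exact absurd (mem_firstLevel.2 ⟨r, hv⟩) v.2
  choose g hg using h1
  choose h hh using h2
  refine ⟨g, h, funext fun v => ?_⟩
  by_cases hv : v ∈ firstLevel f
  · simp [glueForest, hv, hg ⟨v, hv⟩]
  · simp [glueForest, hv, hh ⟨v, hv⟩]

lemma card_isForestMap_firstLevel_eq {V R : Type*} [Fintype V] [DecidableEq V] (J : Finset V) :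
    Nat.card {f : V → V ⊕ R // IsForestMap f ∧ firstLevel f = J} =
      Nat.card R ^ #J *
        Nat.card {h : {v // v ∉ J} → {v // v ∉ J} ⊕ {v // v ∈ J} // IsForestMap h} := by
  have e : ({v // v ∈ J} → R) ×
      {h : {v // v ∉ J} → {v // v ∉ J} ⊕ {v // v ∈ J} // IsForestMap h} ≃
      {f : V → V ⊕ R // IsForestMap f ∧ firstLevel f = J} := by
    refine Equiv.ofBijective (fun p => ⟨glueForest J p.1 p.2.1,
      (isForestMap_glueForest_iff J _ _).2 p.2.2, firstLevel_glueForest J _ _⟩) ⟨?_, ?_⟩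
    · rintro ⟨g, h, hh⟩ ⟨g', h', hh'⟩ H
      have := @glueForest_injective V R _ J (g, h) (g', h') (congrArg Subtype.val H)
      simp_all
    · rintro ⟨f, hf, rfl⟩
      obtain ⟨g, h, hgh⟩ := exists_glueForest_eq f
      exact ⟨(g, ⟨h, (isForestMap_glueForest_iff _ g h).1 (hgh.symm ▸ hf)⟩), Subtype.ext hgh⟩
  rw [← Nat.card_congr e, Nat.card_prod, Nat.card_fun]
  simp

lemma card_isForestMap_filter {V R : Type*} [Fintype V] [DecidableEq V] [Finite R]
    (Q : Finset V → Prop) [DecidablePred Q] :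
    Nat.card {f : V → V ⊕ R // IsForestMap f ∧ Q (firstLevel f)} =
      ∑ J with Q J, Nat.card R ^ #J *
        Nat.card {h : {v // v ∉ J} → {v // v ∉ J} ⊕ {v // v ∈ J} // IsForestMap h} := by
  have e : {f : V → V ⊕ R // IsForestMap f ∧ Q (firstLevel f)} ≃
      Σ J : {J : Finset V // Q J}, {f : V → V ⊕ R // IsForestMap f ∧ firstLevel f = J} :=
    { toFun := fun f => ⟨⟨firstLevel f.1, f.2.2⟩, f.1, f.2.1, rfl⟩
      invFun := fun p => ⟨p.2.1, p.2.2.1, p.2.2.2.symm ▸ p.1.2⟩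
      left_inv := fun f => rfl
      right_inv := by
        rintro ⟨⟨J, hJ⟩, f, hf, hf'⟩
        dsimp only at hf'
        subst hf'
        rfl }
  rw [Nat.card_congr e, Nat.card_sigma]
  simp_rw [card_isForestMap_firstLevel_eq]
  exact (Finset.sum_subtype _ (by simp) fun J => Nat.card R ^ #J *
    Nat.card {h : {v // v ∉ J} → {v // v ∉ J} ⊕ {v // v ∈ J} // IsForestMap h}).symm

lemma not_isForestMap_of_isEmpty {V R : Type*} [Nonempty V] [IsEmpty R] (f : V → V ⊕ R) :
    ¬ IsForestMap f := by
  intro h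
  obtain ⟨v, -, hv⟩ := h.has_min Set.univ Set.univ_nonempty
  rcases hf : f v with u | r
  · exact hv u trivial hf
  · exact isEmptyElim r

lemma sum_pow_card_mul_card_mul_pow {V : Type*} [Fintype V] [DecidableEq V] (k N : ℕ)
    (hV : Fintype.card V = N + 1) (b : ℕ) :
    ∑ J : Finset V, k ^ #J * (#J * b ^ (N + 1 - #J)) = (N + 1) * (k * (k + b) ^ N) := by
  rw [← Finset.powerset_univ,
    Finset.sum_powerset_apply_card (fun m => k ^ m * (m * b ^ (N + 1 - m))),
    Finset.card_univ, hV, Finset.sum_range_succ', add_pow, mul_sum, mul_sum]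
  simp only [zero_mul, mul_zero, smul_zero, add_zero]
  refine sum_congr rfl fun m _ => ?_
  have h := Nat.add_one_mul_choose_eq N m
  rw [Nat.add_sub_add_right, smul_eq_mul]
  calc _ = (N + 1).choose (m + 1) * (m + 1) * (k ^ (m + 1) * b ^ (N - m)) := by ring
    _ = _ := by rw [← h, pow_succ, Nat.cast_id]; ring

/-- The number of rooted forests with `n` non-root vertices and `k` given roots is
`k * (n + k) ^ (n - 1)`. -/
theorem card_isForestMap_mul (V R : Type) [Finite V] [Finite R] :
    Nat.card {f : V → V ⊕ R // IsForestMap f} * (Nat.card V + Nat.card R) =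
      Nat.card R * (Nat.card V + Nat.card R) ^ Nat.card V := by
  induction hn : Nat.card V using Nat.strong_induction_on generalizing V R with
  | _ n ih =>
    classical
    have := Fintype.ofFinite V
    rcases n with _ | N
    · have := Finite.card_eq_zero_iff.1 hn
      have h : ∀ f : V → V ⊕ R, IsForestMap f := fun f => ⟨fun v => isEmptyElim v⟩
      rw [Nat.card_congr (Equiv.subtypeUnivEquiv h), Nat.card_unique]
      simp
    · have hV : Fintype.card V = N + 1 := by rw [← hn, Nat.card_eq_fintype_card]
      have key := card_isForestMap_filter (V := V) (R := R) fun _ => True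
      simp only [and_true, filter_true] at key
      have hJ : ∀ J : Finset V,
          Nat.card {h : {v // v ∉ J} → {v // v ∉ J} ⊕ {v // v ∈ J} // IsForestMap h} * (N + 1) =
            #J * (N + 1) ^ (N + 1 - #J) := by
        intro J
        rcases J.eq_empty_or_nonempty with rfl | hne
        · have : Nonempty V := Fintype.card_pos_iff.1 (by omega)
          have : Nonempty {v : V // v ∉ (∅ : Finset V)} := ⟨⟨Classical.arbitrary V, by simp⟩⟩
          have : IsEmpty {v : V // v ∈ (∅ : Finset V)} := ⟨fun v => notMem_empty _ v.2⟩
          simp [not_isForestMap_of_isEmpty]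
        · have hc : Nat.card {v // v ∉ J} = N + 1 - #J := by
            simp [Fintype.card_subtype_compl, hV]
          have hle : #J ≤ N + 1 := hV ▸ J.card_le_univ
          have hpos := hne.card_pos
          have := ih (N + 1 - #J) (by omega) {v // v ∉ J} {v // v ∈ J} hc
          have hc' : Nat.card {v // v ∈ J} = #J := by simp
          rwa [hc', Nat.sub_add_cancel hle] at this
      have h2 : Nat.card {f : V → V ⊕ R // IsForestMap f} * (N + 1) =
          (N + 1) * (Nat.card R * (Nat.card R + (N + 1)) ^ N) := by
        rw [key, sum_mul, ← sum_pow_card_mul_card_mul_pow (V := V) _ N hV]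
        exact sum_congr rfl fun J _ => by rw [mul_assoc, hJ]
      have h3 := Nat.eq_of_mul_eq_mul_left (Nat.succ_pos N) ((mul_comm _ _).trans h2)
      rw [h3, pow_succ, add_comm (N + 1), mul_assoc]

section ParentGraph

variable {α : Type*} {r : α}

/-- The parent of a vertex, as a vertex of the ambient type with root `r`. -/
def parent (f : {v // v ≠ r} → {v // v ≠ r} ⊕ Unit) (v : {v // v ≠ r}) : α :=
  Sum.elim Subtype.val (fun _ => r) (f v)

/-- The graph joining each vertex other than `r` to its parent. -/
def parentGraph (f : {v // v ≠ r} → {v // v ≠ r} ⊕ Unit) : SimpleGraph α :=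
  SimpleGraph.fromRel fun u w => ∃ h : u ≠ r, parent f ⟨u, h⟩ = w

variable {f : {v // v ≠ r} → {v // v ≠ r} ⊕ Unit}

lemma parent_injective :
    Function.Injective (parent : ({v // v ≠ r} → {v // v ≠ r} ⊕ Unit) → _) := by
  intro f g h
  funext v
  have e := congrFun h v
  simp only [parent] at e
  rcases hf : f v with a | a <;> rcases hg : g v with b | b <;> rw [hf, hg] at e
  · exact congrArg _ (Subtype.ext e)
  · exact absurd e a.2
  · exact absurd e.symm b.2

lemma parent_eq_root_iff (v : {v // v ≠ r}) : parent f v = r ↔ ∃ x, f v = .inr x := by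
  rcases hf : f v with a | a
  · simp [parent, hf, a.2]
  · simp [parent, hf]

lemma parent_eq_coe_iff (v u : {v // v ≠ r}) : parent f v = u ↔ f v = .inl u := by
  rcases hf : f v with a | a
  · simp [parent, hf, Subtype.ext_iff]
  · simp [parent, hf, u.2.symm]

lemma IsForestMap.parent_ne (hf : IsForestMap f) (v : {v // v ≠ r}) : parent f v ≠ v := by
  rw [Ne, parent_eq_coe_iff]
  exact fun h => hf.irrefl.irrefl v h

lemma IsForestMap.adj_parent (hf : IsForestMap f) (v : {v // v ≠ r}) :
    (parentGraph f).Adj v (parent f v) := by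
  rw [parentGraph, SimpleGraph.fromRel_adj]
  exact ⟨(hf.parent_ne v).symm, .inl ⟨v.2, rfl⟩⟩

lemma adj_parentGraph {u w : α} (h : (parentGraph f).Adj u w) :
    (∃ h : u ≠ r, parent f ⟨u, h⟩ = w) ∨ ∃ h : w ≠ r, parent f ⟨w, h⟩ = u := by
  rw [parentGraph, SimpleGraph.fromRel_adj] at h
  exact h.2

lemma IsForestMap.reachable_root (hf : IsForestMap f) {G : SimpleGraph α}
    (hG : ∀ v, G.Adj (v : {v // v ≠ r}) (parent f v)) (v : α) : G.Reachable v r := by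
  by_cases hv : v = r
  · rw [hv]
  · suffices ∀ v : {v // v ≠ r}, G.Reachable v r from this ⟨v, hv⟩
    intro v
    induction v using hf.induction with
    | _ v ih =>
      refine (hG v).reachable.trans ?_
      rcases h : f v with u | x
      · rw [(parent_eq_coe_iff v u).2 h]
        exact ih u h
      · rw [(parent_eq_root_iff v).2 ⟨x, h⟩]

lemma IsForestMap.connected_parentGraph (hf : IsForestMap f) : (parentGraph f).Connected where
  preconnected u v :=
    (hf.reachable_root hf.adj_parent u).trans (hf.reachable_root hf.adj_parent v).symm
  nonempty := ⟨r⟩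

lemma IsForestMap.isTree_parentGraph [Finite α] (hf : IsForestMap f) :
    (parentGraph f).IsTree := by
  refine SimpleGraph.isTree_iff_connected_and_card.2 ⟨hf.connected_parentGraph,
    le_antisymm ?_ hf.connected_parentGraph.card_vert_le_card_edgeSet_add_one⟩
  have hsurj : Function.Surjective fun v : {v // v ≠ r} =>
      (⟨s(v.1, parent f v), hf.adj_parent v⟩ : (parentGraph f).edgeSet) := by
    rintro ⟨e, he⟩
    induction e using Sym2.ind with
    | _ u w =>
      have huw : (parentGraph f).Adj u w := he
      rcases adj_parentGraph huw with ⟨h, rfl⟩ | ⟨h, rfl⟩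
      · exact ⟨⟨u, h⟩, rfl⟩
      · exact ⟨⟨w, h⟩, Subtype.ext Sym2.eq_swap⟩
  have h1 : Nat.card (parentGraph f).edgeSet ≤ _ := Nat.card_le_card_of_surjective _ hsurj
  have h2 : Nat.card {v // v ≠ r} < Nat.card α :=
    Finite.card_subtype_lt (x := r) (by simp)
  exact h1.trans_lt h2

lemma SimpleGraph.Connected.exists_adj_dist_lt {G : SimpleGraph α} (hG : G.Connected) {v : α}
    (hv : v ≠ r) : ∃ w, G.Adj v w ∧ G.dist w r < G.dist v r := by
  obtain ⟨p, hp⟩ := hG.exists_walk_length_eq_dist v r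
  cases p with
  | nil => exact absurd rfl hv
  | cons h q =>
    refine ⟨_, h, ?_⟩
    rw [← hp, SimpleGraph.Walk.length_cons]
    exact Nat.lt_succ_of_le (SimpleGraph.dist_le q)

lemma IsForestMap.eq_parent_of_dist_lt (hf : IsForestMap f) (v : {v // v ≠ r}) {w : α}
    (hvw : (parentGraph f).Adj v w) (hlt : (parentGraph f).dist w r < (parentGraph f).dist v r) :
    w = parent f v := by
  induction hd : (parentGraph f).dist v r using Nat.strong_induction_on generalizing v w with
  | _ d ih =>
    rcases adj_parentGraph hvw with ⟨h, h'⟩ | ⟨h, h'⟩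
    · exact h'.symm
    · obtain ⟨x, hx, hxw⟩ := hf.connected_parentGraph.exists_adj_dist_lt h
      have := ih _ (hd ▸ hlt) ⟨w, h⟩ hx hxw rfl
      rw [h'] at this
      subst this
      omega

lemma IsForestMap.eq_of_parentGraph_eq {g : {v // v ≠ r} → {v // v ≠ r} ⊕ Unit}
    (hf : IsForestMap f) (hg : IsForestMap g) (h : parentGraph f = parentGraph g) : f = g := by
  refine parent_injective (funext fun v => ?_)
  obtain ⟨w, hw, hlt⟩ := hf.connected_parentGraph.exists_adj_dist_lt v.2
  rw [← hf.eq_parent_of_dist_lt v hw hlt]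
  rw [h] at hw hlt
  exact hg.eq_parent_of_dist_lt v hw hlt

lemma SimpleGraph.IsTree.exists_parentGraph_eq {G : SimpleGraph α} (hG : G.IsTree) (r : α) :
    ∃ f : {v // v ≠ r} → {v // v ≠ r} ⊕ Unit, IsForestMap f ∧ parentGraph f = G := by
  classical
  have h1 : ∀ v : {v // v ≠ r}, ∃ w, G.Adj v w ∧ G.dist w r < G.dist v r := fun v =>
    hG.connected.exists_adj_dist_lt v.2
  choose p hadj hlt using h1
  let f : {v // v ≠ r} → {v // v ≠ r} ⊕ Unit := fun v =>
    if h : p v = r then .inr () else .inl ⟨p v, h⟩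
  have hp : ∀ v, parent f v = p v := fun v => by
    by_cases h : p v = r <;> simp [parent, f, h]
  have hf : IsForestMap f := by
    refine Subrelation.wf ?_ (measure fun v : {v // v ≠ r} => G.dist v r).wf
    intro u v huv
    rw [← parent_eq_coe_iff, hp] at huv
    have := hlt v
    rwa [huv] at this
  refine ⟨f, hf, ?_⟩
  have hle : parentGraph f ≤ G := by
    intro u w huw
    rcases adj_parentGraph huw with ⟨h, h'⟩ | ⟨h, h'⟩
    · rw [← h', hp]; exact hadj ⟨u, h⟩
    · rw [← h', hp]; exact (hadj ⟨w, h⟩).symm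
  exact le_antisymm hle
    ((SimpleGraph.isTree_iff_minimal_connected.1 hG).2 hf.connected_parentGraph hle)

lemma IsForestMap.card_neighborSet_root [Fintype α] [DecidableEq α] (hf : IsForestMap f) :
    Nat.card ((parentGraph f).neighborSet r) = #(firstLevel f) := by
  have e : {v // v ∈ firstLevel f} ≃ (parentGraph f).neighborSet r := by
    refine Equiv.ofBijective (fun v => ⟨v.1.1, ?_⟩) ⟨?_, ?_⟩
    · have := (hf.adj_parent v.1).symm
      rwa [(parent_eq_root_iff _).2 (mem_firstLevel.1 v.2)] at this
    · intro u v h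
      exact Subtype.ext (Subtype.ext (Subtype.mk.inj h))
    · rintro ⟨w, hw⟩
      rcases adj_parentGraph hw with ⟨h, h'⟩ | ⟨h, h'⟩
      · exact absurd rfl h
      · exact ⟨⟨⟨w, h⟩, mem_firstLevel.2 ((parent_eq_root_iff _).1 h')⟩, rfl⟩
  rw [← Nat.card_congr e]
  simp

end ParentGraph

lemma card_isTree_card_neighborSet_eq {α : Type*} [Fintype α] [DecidableEq α] (r : α) (d : ℕ) :
    Nat.card {G : SimpleGraph α // G.IsTree ∧ Nat.card (G.neighborSet r) = d} =
      Nat.card {f : {v // v ≠ r} → {v // v ≠ r} ⊕ Unit //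
        IsForestMap f ∧ #(firstLevel f) = d} := by
  refine (Nat.card_congr (Equiv.ofBijective (fun f => ⟨parentGraph f.1,
    f.2.1.isTree_parentGraph, f.2.1.card_neighborSet_root.trans f.2.2⟩) ⟨?_, ?_⟩)).symm
  · intro f g h
    exact Subtype.ext (f.2.1.eq_of_parentGraph_eq g.2.1 (congrArg Subtype.val h))
  · rintro ⟨G, hG, hd⟩
    obtain ⟨f, hf, rfl⟩ := hG.exists_parentGraph_eq r
    exact ⟨⟨f, hf, hf.card_neighborSet_root.symm.trans hd⟩, rfl⟩

lemma card_isForestMap_card_firstLevel_eq_one {V : Type} [Fintype V] [DecidableEq V] (N : ℕ)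
    (hV : Fintype.card V = N + 1) :
    Nat.card {f : V → V ⊕ Unit // IsForestMap f ∧ #(firstLevel f) = 1} = (N + 1) ^ N := by
  rw [card_isForestMap_filter fun J : Finset V => #J = 1]
  have hJ : ∀ J ∈ univ.filter (fun J : Finset V => #J = 1), Nat.card Unit ^ #J *
      Nat.card {h : {v // v ∉ J} → {v // v ∉ J} ⊕ {v // v ∈ J} // IsForestMap h} * (N + 1) =
        (N + 1) ^ N := by
    intro J hJ
    have hJ1 : #J = 1 := (mem_filter.1 hJ).2
    have hc : Nat.card {v // v ∉ J} = N := by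
      simp [Fintype.card_subtype_compl, hV, hJ1]
    have hc' : Nat.card {v // v ∈ J} = 1 := by simp [hJ1]
    have := card_isForestMap_mul {v // v ∉ J} {v // v ∈ J}
    rw [hc, hc', one_mul] at this
    simpa using this
  have hcard : #(univ.filter fun J : Finset V => #J = 1) = N + 1 := by
    rw [univ_filter_card_eq, card_powersetCard]
    simp [hV]
  refine Nat.eq_of_mul_eq_mul_right (Nat.succ_pos N) ?_
  rw [sum_mul, sum_congr rfl hJ, sum_const, hcard, smul_eq_mul, mul_comm]

/-- For `n ≥ 2`, the number of labeled rooted trees on `Fin n` whose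
root has valence `1`, i.e. pairs `(G, r)` with `G` a tree on `Fin n` and `r` a
vertex of degree `1` (having exactly one neighbour), equals `n · (n-1)^(n-2)`. -/
theorem card_rooted_trees_root_valence_one (n : ℕ) (hn : 2 ≤ n) :
    Nat.card {p : SimpleGraph (Fin n) × Fin n //
        p.1.IsTree ∧ Nat.card (p.1.neighborSet p.2) = 1}
      = n * (n - 1) ^ (n - 2) := by
  obtain ⟨N, rfl⟩ := Nat.exists_eq_add_of_le' hn
  have e : {p : SimpleGraph (Fin (N + 2)) × Fin (N + 2) //
      p.1.IsTree ∧ Nat.card (p.1.neighborSet p.2) = 1} ≃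
      Σ r : Fin (N + 2), {G : SimpleGraph (Fin (N + 2)) //
        G.IsTree ∧ Nat.card (G.neighborSet r) = 1} :=
    { toFun := fun p => ⟨p.1.2, p.1.1, p.2⟩
      invFun := fun q => ⟨(q.2.1, q.1), q.2.2⟩
      left_inv := fun _ => rfl
      right_inv := fun _ => rfl }
  rw [Nat.card_congr e, Nat.card_sigma]
  have hr : ∀ r : Fin (N + 2), Nat.card {G : SimpleGraph (Fin (N + 2)) //
      G.IsTree ∧ Nat.card (G.neighborSet r) = 1} = (N + 1) ^ N := by
    intro r
    rw [card_isTree_card_neighborSet_eq]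
    exact card_isForestMap_card_firstLevel_eq_one N (by simp [Fintype.card_subtype_compl])
  rw [sum_congr rfl fun r _ => hr r]
  simp
end
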